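/- arXiv:1609.03797 — 7 statements merged into one kernel-verified Lean document; each statement's English description precedes it below -/
import Mathlib

section
/- Let C and E be finite types, let D2 : Matrix C E ℝ and D̄1 : Matrix E C ℝ satisfy D2ᵀ = −D̄1, and let H : (C → ℝ) × (E → ℝ) → ℝ be differentiable. Let m : ℝ → (C → ℝ) and u : ℝ → (E → ℝ) be differentiable, and let Φ : ℝ → (C → ℝ), F : ℝ → (E → ℝ), Q : ℝ → Matrix E E ℝ be functions such that for every t: (i) the Fréchet derivative of H at (m(t), u(t)) applied to any variation (δm, δu) equals Σ_{i∈C} Φ(t)(i)·δm(i) + Σ_{e∈E} F(t)(e)·δu(e); (ii) Q(t)ᵀ = −Q(t); (iii) m'(t) = −D2 · F(t) and u'(t) = Q(t) · F(t) − D̄1 · Φ(t). Then t ↦ H(m(t), u(t)) is constant. -/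
open Matrix

/-- Total energy conservation for the C-grid shallow water scheme: for any
discrete Hamiltonian `H`, the dynamics `m' = -D2 F`, `u' = Q F - D̄1 Φ`
(with `(Φ, F)` the gradient of `H`) conserves `H`, provided `D2ᵀ = -D̄1`
and `Q` is anti-symmetric. -/
theorem cgrid_energy_conservation
    {C E : Type*} [Fintype C] [Fintype E]
    (D2 : Matrix C E ℝ) (D1bar : Matrix E C ℝ)
    (hD : D2ᵀ = -D1bar)
    (H : (C → ℝ) × (E → ℝ) → ℝ) (hH : Differentiable ℝ H)
    (m : ℝ → C → ℝ) (u : ℝ → E → ℝ)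
    (hm : Differentiable ℝ m) (hu : Differentiable ℝ u)
    (Φ : ℝ → C → ℝ) (F : ℝ → E → ℝ) (Q : ℝ → Matrix E E ℝ)
    (hgrad : ∀ (t : ℝ) (δm : C → ℝ) (δu : E → ℝ),
      fderiv ℝ H (m t, u t) (δm, δu) = ∑ i, Φ t i * δm i + ∑ e, F t e * δu e)
    (hQ : ∀ t : ℝ, (Q t)ᵀ = -(Q t))
    (hmt : ∀ t : ℝ, deriv m t = -(D2.mulVec (F t)))
    (hut : ∀ t : ℝ, deriv u t = (Q t).mulVec (F t) - D1bar.mulVec (Φ t)) :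
    ∀ t s : ℝ, H (m t, u t) = H (m s, u s) := by
  have key : ∀ t, HasDerivAt (fun t => H (m t, u t)) 0 t := by
    intro t
    have h1 : HasDerivAt (fun t => (m t, u t)) (deriv m t, deriv u t) t :=
      (hm t).hasDerivAt.prodMk (hu t).hasDerivAt
    have h2 := (hH (m t, u t)).hasFDerivAt.comp_hasDerivAt t h1
    have hz : fderiv ℝ H (m t, u t) (deriv m t, deriv u t) = 0 := by
      rw [hgrad, hmt, hut]
      change Φ t ⬝ᵥ (-(D2 *ᵥ F t)) + F t ⬝ᵥ (Q t *ᵥ F t - D1bar *ᵥ Φ t) = 0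
      have hq : F t ⬝ᵥ (Q t *ᵥ F t) = -(F t ⬝ᵥ (Q t *ᵥ F t)) := by
        conv_lhs => rw [dotProduct_mulVec, ← mulVec_transpose, hQ, neg_mulVec,
          neg_dotProduct, dotProduct_comm]
      have hd : F t ⬝ᵥ (D1bar *ᵥ Φ t) = -(Φ t ⬝ᵥ (D2 *ᵥ F t)) := by
        rw [dotProduct_mulVec (Φ t), ← mulVec_transpose, hD, neg_mulVec,
          neg_dotProduct, neg_neg, dotProduct_comm]
      rw [dotProduct_neg, dotProduct_sub, hd]
      linarith
    rw [hz] at h2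
    exact h2
  intro t s
  exact is_const_of_deriv_eq_zero (fun t => (key t).differentiableAt)
    (fun t => (key t).deriv) t s
end

section
/- Let C, E, V be finite types and let D1 : Matrix E V ℝ, D̄1 : Matrix E C ℝ, D2 : Matrix C E ℝ, D̄2 : Matrix V E ℝ, R : Matrix V C ℝ be matrices satisfying D2ᵀ = −D̄1, D̄2ᵀ = D1 and D2 * D1 = 0. Let f : V → ℝ, and let Q : (V → ℝ) → Matrix E E ℝ satisfy, for every q : V → ℝ, the constraint Q(q)ᵀ · (D1 · q) = D̄1 · (Rᵀ · (fun v => (q v)²/2)). Let m : ℝ → (C → ℝ) and u : ℝ → (E → ℝ) be differentiable, and F : ℝ → (E → ℝ), Φ : ℝ → (C → ℝ) be functions such that for all t: (R · m(t))(v) ≠ 0 for every v, m'(t) = −D2 · F(t), and u'(t) = Q(q(t)) · F(t) − D̄1 · Φ(t), where q(t)(v) = ((D̄2 · u(t))(v) + f(v)) / (R · m(t))(v). Then the discrete potential enstrophy Z(t) = Σ_{v∈V} ((D̄2 · u(t))(v) + f(v))² / (2 · (R · m(t))(v)) is constant in time. -/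
open Matrix

/-- Potential enstrophy conservation for the C-grid shallow water scheme:
if the operator `Q` satisfies the discrete potential enstrophy constraint
`Q(q)ᵀ (D1 q) = D̄1 (Rᵀ (q²/2))` for every `q`, then along the dynamics
`m' = -D2 F`, `u' = Q(q) F - D̄1 Φ` (with `q = (D̄2 u + f)/(R m)`), the discrete
potential enstrophy `Z = ∑_v (D̄2 u + f)_v² / (2 (R m)_v)` is constant. -/
theorem cgrid_potential_enstrophy_conservation
    {C E V : Type*} [Fintype C] [Fintype E] [Fintype V]
    (D1 : Matrix E V ℝ) (D1bar : Matrix E C ℝ)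
    (D2 : Matrix C E ℝ) (D2bar : Matrix V E ℝ) (R : Matrix V C ℝ)
    (hD2 : D2ᵀ = -D1bar) (hD2bar : D2barᵀ = D1) (hDD : D2 * D1 = 0)
    (f : V → ℝ)
    (Q : (V → ℝ) → Matrix E E ℝ)
    (hQ : ∀ q : V → ℝ,
      (Q q)ᵀ.mulVec (D1.mulVec q) = D1bar.mulVec (Rᵀ.mulVec (fun v => (q v) ^ 2 / 2)))
    (m : ℝ → C → ℝ) (u : ℝ → E → ℝ)
    (hm : Differentiable ℝ m) (hu : Differentiable ℝ u)
    (F : ℝ → E → ℝ) (Φ : ℝ → C → ℝ)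
    (hmass : ∀ (t : ℝ) (v : V), (R.mulVec (m t)) v ≠ 0)
    (hmt : ∀ t : ℝ, deriv m t = -(D2.mulVec (F t)))
    (hut : ∀ t : ℝ, deriv u t =
      (Q (fun v => ((D2bar.mulVec (u t)) v + f v) / (R.mulVec (m t)) v)).mulVec (F t)
        - D1bar.mulVec (Φ t)) :
    ∀ t s : ℝ,
      (∑ v, ((D2bar.mulVec (u t)) v + f v) ^ 2 / (2 * (R.mulVec (m t)) v)) =
      (∑ v, ((D2bar.mulVec (u s)) v + f v) ^ 2 / (2 * (R.mulVec (m s)) v)) := by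
  have hlin2 : ∀ (g : ℝ → C → ℝ)
      (g' : C → ℝ) (t : ℝ), HasDerivAt g g' t → ∀ a,
      HasDerivAt (fun t => (R.mulVec (g t)) a) ((R.mulVec g') a) t := by
    intro g g' t hg a
    simp only [Matrix.mulVec, dotProduct]
    exact HasDerivAt.fun_sum fun b _ => ((hasDerivAt_pi.1 hg) b).const_mul (R a b)
  have hlin1 : ∀ (g : ℝ → E → ℝ)
      (g' : E → ℝ) (t : ℝ), HasDerivAt g g' t → ∀ a,
      HasDerivAt (fun t => (D2bar.mulVec (g t)) a) ((D2bar.mulVec g') a) t := by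
    intro g g' t hg a
    simp only [Matrix.mulVec, dotProduct]
    exact HasDerivAt.fun_sum fun b _ => ((hasDerivAt_pi.1 hg) b).const_mul (D2bar a b)
  have key : ∀ t, HasDerivAt (fun t => ∑ v, ((D2bar.mulVec (u t)) v + f v) ^ 2 /
      (2 * (R.mulVec (m t)) v)) 0 t := by
    intro t
    set q : V → ℝ := fun v => ((D2bar.mulVec (u t)) v + f v) / (R.mulVec (m t)) v with hq
    have h1 : HasDerivAt (fun t => ∑ v, ((D2bar.mulVec (u t)) v + f v) ^ 2 /
        (2 * (R.mulVec (m t)) v))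
        (∑ v, (q v * (D2bar.mulVec (deriv u t)) v
          - (q v ^ 2 / 2) * (R.mulVec (deriv m t)) v)) t := by
      refine HasDerivAt.fun_sum fun v _ => ?_
      have hv := hmass t v
      have a := ((hlin1 u _ t (hu t).hasDerivAt v).add_const (f v)).pow 2
      have b := (hlin2 m _ t (hm t).hasDerivAt v).const_mul 2
      have c := a.fun_div b (mul_ne_zero two_ne_zero hv)
      refine c.congr_deriv ?_
      simp only [hq, Pi.pow_apply]
      field_simp
      push_cast
      ring
    refine h1.congr_deriv ?_
    have e1 : D1bar = -D2ᵀ := by rw [hD2, neg_neg]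
    have hz : D2bar * D2ᵀ = 0 := by
      have := congrArg Matrix.transpose hDD
      rwa [Matrix.transpose_mul, ← hD2bar, Matrix.transpose_transpose,
        Matrix.transpose_zero] at this
    have hA : q ⬝ᵥ D2bar.mulVec ((Q q).mulVec (F t))
        = (D1bar.mulVec (Rᵀ.mulVec (fun v => (q v) ^ 2 / 2))) ⬝ᵥ F t := by
      rw [← hQ q, ← hD2bar, Matrix.mulVec_transpose, Matrix.mulVec_transpose,
        Matrix.dotProduct_mulVec, Matrix.dotProduct_mulVec]
    have hB : (fun v => (q v) ^ 2 / 2) ⬝ᵥ R.mulVec (D2.mulVec (F t))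
        = -((D1bar.mulVec (Rᵀ.mulVec (fun v => (q v) ^ 2 / 2))) ⬝ᵥ F t) := by
      rw [e1, Matrix.neg_mulVec, neg_dotProduct, neg_neg, Matrix.mulVec_transpose,
        Matrix.mulVec_transpose, Matrix.dotProduct_mulVec, Matrix.dotProduct_mulVec]
    have hC : D2bar.mulVec (D1bar.mulVec (Φ t)) = 0 := by
      rw [e1, Matrix.mulVec_mulVec, Matrix.mul_neg, hz, neg_zero, Matrix.zero_mulVec]
    rw [Finset.sum_sub_distrib]
    change q ⬝ᵥ D2bar.mulVec (deriv u t)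
      - (fun v => (q v) ^ 2 / 2) ⬝ᵥ R.mulVec (deriv m t) = 0
    rw [hut t, hmt t, Matrix.mulVec_sub, hC, sub_zero, Matrix.mulVec_neg, dotProduct_neg,
      hA, hB]
    ring
  intro t s
  exact is_const_of_deriv_eq_zero (fun x => (key x).differentiableAt) (fun x => (key x).deriv) t s
end

section
/- Let C and E be finite types, let I : Matrix C C ℝ and 𝓗 : Matrix E E ℝ be symmetric matrices, let D2 : Matrix C E ℝ and D̄1 : Matrix E C ℝ satisfy D2ᵀ = −D̄1, and let W : Matrix E E ℝ satisfy Wᵀ = −W. Let f, g, H₀ be real constants. If m : ℝ → (C → ℝ) and u : ℝ → (E → ℝ) are differentiable and satisfy the linearized C-grid equations m'(t) = −H₀ · (D2 · (𝓗 · u(t))) and u'(t) = f · (W · (𝓗 · u(t))) − g · (D̄1 · (I · m(t))), then the quadratic energy E(t) = (g/2)·⟨m(t), I · m(t)⟩ + (H₀/2)·⟨u(t), 𝓗 · u(t)⟩ is constant in time, where ⟨a, b⟩ denotes the standard dot product. -/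
open Matrix

lemma quad_hasDerivAt {n : Type*} [Fintype n] (A : Matrix n n ℝ) (hA : Aᵀ = A)
    (x : ℝ → n → ℝ) (x' : n → ℝ) (t : ℝ) (hx : HasDerivAt x x' t) :
    HasDerivAt (fun t => x t ⬝ᵥ A.mulVec (x t)) (2 * (x' ⬝ᵥ A.mulVec (x t))) t := by
  have hx1 := hasDerivAt_pi.1 hx
  have h2 : ∀ i, HasDerivAt (fun t => A.mulVec (x t) i) (A.mulVec x' i) t := by
    intro i
    simp only [Matrix.mulVec, dotProduct]
    exact HasDerivAt.fun_sum fun j _ => (hx1 j).const_mul (A i j)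
  have h3 : HasDerivAt (fun t => x t ⬝ᵥ A.mulVec (x t))
      (∑ i, (x' i * A.mulVec (x t) i + x t i * A.mulVec x' i)) t := by
    simp only [dotProduct]
    exact HasDerivAt.fun_sum fun i _ => (hx1 i).mul (h2 i)
  convert h3 using 1
  rw [Finset.sum_add_distrib]
  change _ = x' ⬝ᵥ A.mulVec (x t) + x t ⬝ᵥ A.mulVec x'
  have : x t ⬝ᵥ A.mulVec x' = x' ⬝ᵥ A.mulVec (x t) := by
    rw [Matrix.dotProduct_mulVec, ← Matrix.mulVec_transpose, hA, dotProduct_comm]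
  rw [this]; ring

/-- Linear stability of the linearized C-grid scheme: with symmetric Hodge
stars `I` and `𝓗`, adjoint exterior derivatives `D2ᵀ = -D̄1` and
anti-symmetric `W`, the linearized dynamics
`m' = -H₀ D2 𝓗 u`, `u' = f W 𝓗 u - g D̄1 I m` conserves the quadratic energy
`(g/2)⟨m, I m⟩ + (H₀/2)⟨u, 𝓗 u⟩`. -/
theorem cgrid_linear_energy_conservation
    {C E : Type*} [Fintype C] [Fintype E]
    (I : Matrix C C ℝ) (HM : Matrix E E ℝ)
    (hI : Iᵀ = I) (hHM : HMᵀ = HM)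
    (D2 : Matrix C E ℝ) (D1bar : Matrix E C ℝ) (hD : D2ᵀ = -D1bar)
    (W : Matrix E E ℝ) (hW : Wᵀ = -W)
    (f g H₀ : ℝ)
    (m : ℝ → C → ℝ) (u : ℝ → E → ℝ)
    (hm : Differentiable ℝ m) (hu : Differentiable ℝ u)
    (hmt : ∀ t : ℝ, deriv m t = -(H₀ • D2.mulVec (HM.mulVec (u t))))
    (hut : ∀ t : ℝ, deriv u t =
      f • W.mulVec (HM.mulVec (u t)) - g • D1bar.mulVec (I.mulVec (m t))) :
    ∀ t s : ℝ,
      (g / 2) * (m t ⬝ᵥ I.mulVec (m t)) + (H₀ / 2) * (u t ⬝ᵥ HM.mulVec (u t)) =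
      (g / 2) * (m s ⬝ᵥ I.mulVec (m s)) + (H₀ / 2) * (u s ⬝ᵥ HM.mulVec (u s)) := by
  intro t s
  have key : ∀ t, HasDerivAt (fun t => (g / 2) * (m t ⬝ᵥ I.mulVec (m t)) +
      (H₀ / 2) * (u t ⬝ᵥ HM.mulVec (u t))) 0 t := by
    intro t
    have h1 := quad_hasDerivAt I hI m _ t (hm t).hasDerivAt
    have h2 := quad_hasDerivAt HM hHM u _ t (hu t).hasDerivAt
    refine ((h1.const_mul (g / 2)).fun_add (h2.const_mul (H₀ / 2))).congr_deriv ?_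
    rw [hmt, hut]
    generalize HM.mulVec (u t) = a
    generalize I.mulVec (m t) = b
    have e1 : W.mulVec a ⬝ᵥ a = 0 := by
      have : W.mulVec a ⬝ᵥ a = -(W.mulVec a ⬝ᵥ a) := by
        conv_lhs => rw [dotProduct_comm, Matrix.dotProduct_mulVec, ← Matrix.mulVec_transpose,
          hW, Matrix.neg_mulVec, neg_dotProduct]
      linarith
    have e2 : D2.mulVec a ⬝ᵥ b = -(D1bar.mulVec b ⬝ᵥ a) := by
      rw [dotProduct_comm, Matrix.dotProduct_mulVec, ← Matrix.mulVec_transpose,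
          hD, Matrix.neg_mulVec, neg_dotProduct]
    rw [neg_dotProduct, sub_dotProduct, smul_dotProduct, smul_dotProduct, smul_dotProduct, e1, e2]
    simp only [smul_eq_mul]
    ring
  exact is_const_of_deriv_eq_zero (fun t => (key t).differentiableAt) (fun t => (key t).deriv) t s
end

section
/- Let n be a natural number and let T : ℝⁿ → (Fin n → Fin n → Fin n → ℝ) be a state-dependent totally anti-symmetric tensor field: for every x and all indices i, j, k, T(x) i j k = −T(x) j i k and T(x) i j k = −T(x) i k j. Let H, Z : ℝⁿ → ℝ be differentiable with gradient fields G_H, G_Z : ℝⁿ → ℝⁿ. If x : ℝ → ℝⁿ is differentiable and satisfies, for all t and all i, x'(t)(i) = Σ_{j,k} T(x(t)) i j k · G_H(x(t))(j) · G_Z(x(t))(k), then both t ↦ H(x(t)) and t ↦ Z(x(t)) are constant. -/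
open Matrix

theorem antisymm_sum_zero {n : ℕ} (g : Fin n → Fin n → ℝ) (hg : ∀ i j, g i j = - g j i) :
    ∑ i, ∑ j, g i j = 0 := by
  have h : ∑ i, ∑ j, g i j = - ∑ i, ∑ j, g i j := by
    conv_lhs => rw [Finset.sum_comm]
    simp only [← Finset.sum_neg_distrib]
    exact Finset.sum_congr rfl fun i _ => Finset.sum_congr rfl fun j _ => hg j i
  linarith

theorem const_along {n : ℕ} (F : (Fin n → ℝ) → ℝ) (G : (Fin n → ℝ) → (Fin n → ℝ))
    (hF : Differentiable ℝ F) (hG : ∀ (x v : Fin n → ℝ), fderiv ℝ F x v = G x ⬝ᵥ v)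
    (x : ℝ → (Fin n → ℝ)) (hx : Differentiable ℝ x)
    (h0 : ∀ t, G (x t) ⬝ᵥ deriv x t = 0) (t s : ℝ) : F (x t) = F (x s) := by
  have hd : ∀ t, HasDerivAt (F ∘ x) 0 t := by
    intro t
    have h := (hF (x t)).hasFDerivAt.comp_hasDerivAt t (hx t).hasDerivAt
    rwa [hG, h0] at h
  exact is_const_of_deriv_eq_zero (f := F ∘ x) (fun t => (hd t).differentiableAt)
    (fun t => (hd t).deriv) t s

/-- Nambu dynamics conserves both `H` and `Z`: if `T(x)` is a totally
anti-symmetric tensor field and `x'ᵢ = ∑_{j,k} T(x) i j k (∇H)ⱼ (∇Z)ₖ`,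
then both `H` and `Z` are constant along the flow. -/
theorem nambu_conserves_H_and_Z
    (n : ℕ)
    (T : (Fin n → ℝ) → (Fin n → Fin n → Fin n → ℝ))
    (hT12 : ∀ (x : Fin n → ℝ) (i j k : Fin n), T x i j k = -T x j i k)
    (hT23 : ∀ (x : Fin n → ℝ) (i j k : Fin n), T x i j k = -T x i k j)
    (H Z : (Fin n → ℝ) → ℝ)
    (GH GZ : (Fin n → ℝ) → (Fin n → ℝ))
    (hH : Differentiable ℝ H) (hZ : Differentiable ℝ Z)
    (hGH : ∀ (x v : Fin n → ℝ), fderiv ℝ H x v = GH x ⬝ᵥ v)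
    (hGZ : ∀ (x v : Fin n → ℝ), fderiv ℝ Z x v = GZ x ⬝ᵥ v)
    (x : ℝ → (Fin n → ℝ)) (hx : Differentiable ℝ x)
    (hode : ∀ (t : ℝ) (i : Fin n),
      deriv x t i = ∑ j, ∑ k, T (x t) i j k * GH (x t) j * GZ (x t) k) :
    (∀ t s : ℝ, H (x t) = H (x s)) ∧ (∀ t s : ℝ, Z (x t) = Z (x s)) := by
  refine ⟨const_along H GH hH hGH x hx fun t => ?_, const_along Z GZ hZ hGZ x hx fun t => ?_⟩
  · simp only [dotProduct, hode, Finset.mul_sum]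
    refine antisymm_sum_zero _ fun i j => ?_
    rw [← Finset.sum_neg_distrib]
    refine Finset.sum_congr rfl fun k _ => ?_
    rw [hT12 (x t) i j k]; ring
  · simp only [dotProduct, hode, Finset.mul_sum]
    rw [Finset.sum_comm]
    refine Finset.sum_eq_zero fun j _ => antisymm_sum_zero _ fun i k => ?_
    rw [hT12 (x t) i j k, hT23 (x t) j i k, hT12 (x t) j k i]; ring
end

section
/- Let n and m be natural numbers, let P : Matrix (Fin m) (Fin n) ℝ be a matrix, and let A : ℝⁿ → Matrix (Fin m) (Fin m) ℝ satisfy A(x)ᵀ = −A(x) for every x. Let H : ℝⁿ → ℝ be differentiable with gradient field G_H, and suppose x : ℝ → ℝⁿ is differentiable with x'(t) = Pᵀ · (A(x(t)) · (P · G_H(x(t)))) for all t. Then (a) t ↦ H(x(t)) is constant; and (b) for any differentiable Z : ℝⁿ → ℝ with gradient field G_Z satisfying P · G_Z(x) = 0 for every x, the function t ↦ Z(x(t)) is also constant. -/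
open Matrix

/-- The doubly anti-symmetric bracket `x' = Pᵀ A(x) P ∇H(x)` (with `A(x)`
skew-symmetric) conserves `H`, and also conserves any `Z` whose gradient is
annihilated by `P` at every state. -/
theorem doubly_antisymmetric_bracket_conservation
    (n m : ℕ)
    (P : Matrix (Fin m) (Fin n) ℝ)
    (A : (Fin n → ℝ) → Matrix (Fin m) (Fin m) ℝ)
    (hA : ∀ x : Fin n → ℝ, (A x)ᵀ = -(A x))
    (H : (Fin n → ℝ) → ℝ) (GH : (Fin n → ℝ) → (Fin n → ℝ))
    (hH : Differentiable ℝ H)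
    (hGH : ∀ (x v : Fin n → ℝ), fderiv ℝ H x v = GH x ⬝ᵥ v)
    (x : ℝ → (Fin n → ℝ)) (hx : Differentiable ℝ x)
    (hode : ∀ t : ℝ,
      deriv x t = Pᵀ.mulVec ((A (x t)).mulVec (P.mulVec (GH (x t))))) :
    (∀ t s : ℝ, H (x t) = H (x s)) ∧
    (∀ (Z : (Fin n → ℝ) → ℝ) (GZ : (Fin n → ℝ) → (Fin n → ℝ)),
      Differentiable ℝ Z →
      (∀ (y v : Fin n → ℝ), fderiv ℝ Z y v = GZ y ⬝ᵥ v) →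
      (∀ y : Fin n → ℝ, P.mulVec (GZ y) = 0) →
      ∀ t s : ℝ, Z (x t) = Z (x s)) := by
  have key : ∀ (F : (Fin n → ℝ) → ℝ) (G : (Fin n → ℝ) → (Fin n → ℝ)),
      Differentiable ℝ F →
      (∀ (y v : Fin n → ℝ), fderiv ℝ F y v = G y ⬝ᵥ v) →
      (∀ t, (P.mulVec (G (x t))) ⬝ᵥ ((A (x t)).mulVec (P.mulVec (GH (x t)))) = 0) →
      ∀ t s : ℝ, F (x t) = F (x s) := by
    intro F G hF hG h0
    have hd : ∀ t, HasDerivAt (fun t => F (x t)) 0 t := by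
      intro t
      have h := (hF (x t)).hasFDerivAt.comp_hasDerivAt t (hx t).hasDerivAt
      rw [hG, hode, dotProduct_mulVec, vecMul_transpose, h0] at h
      exact h
    exact is_const_of_deriv_eq_zero (fun t => (hd t).differentiableAt) (fun t => (hd t).deriv)
  refine ⟨key H GH hH hGH ?_, ?_⟩
  · intro t
    have h : ∀ w : Fin m → ℝ, w ⬝ᵥ (A (x t)).mulVec w = -(w ⬝ᵥ (A (x t)).mulVec w) := by
      intro w
      conv_lhs => rw [dotProduct_mulVec, ← mulVec_transpose, hA, neg_mulVec, neg_dotProduct,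
        dotProduct_comm]
    have := h (P.mulVec (GH (x t)))
    linarith
  · intro Z GZ hZ hGZ h0
    refine key Z GZ hZ hGZ ?_
    intro t
    rw [h0, zero_dotProduct]
end

section
/- Let n be a natural number, L : Matrix (Fin n) (Fin n) ℝ a symmetric matrix (Lᵀ = L), and f, g, H₀ real constants. If h, ζ, μ : ℝ → (Fin n → ℝ) are differentiable and satisfy the linearized Z-grid equations h'(t) = −H₀ · μ(t), ζ'(t) = −f · μ(t), and μ'(t) = −g · (L · h(t)) + f · ζ(t), then the quantity E(t) = (H₀/2)·(⟨μ(t), μ(t)⟩ + ⟨ζ(t), ζ(t)⟩) − (g/2)·⟨h(t), L · h(t)⟩ is constant in time, where ⟨·,·⟩ is the standard dot product. -/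
open Matrix

lemma hasDerivAt_dot {n : ℕ} {u v : ℝ → Fin n → ℝ} {u' v' : Fin n → ℝ} {t : ℝ}
    (hu : HasDerivAt u u' t) (hv : HasDerivAt v v' t) :
    HasDerivAt (fun t => u t ⬝ᵥ v t) (u' ⬝ᵥ v t + u t ⬝ᵥ v') t := by
  have h1 := hasDerivAt_pi.1 hu
  have h2 := hasDerivAt_pi.1 hv
  simp only [dotProduct, ← Finset.sum_add_distrib]
  exact HasDerivAt.fun_sum fun i _ => (h1 i).mul (h2 i)

lemma hasDerivAt_mulVec' {n : ℕ} (L : Matrix (Fin n) (Fin n) ℝ) {v : ℝ → Fin n → ℝ}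
    {v' : Fin n → ℝ} {t : ℝ} (hv : HasDerivAt v v' t) :
    HasDerivAt (fun t => L.mulVec (v t)) (L.mulVec v') t := by
  have h2 := hasDerivAt_pi.1 hv
  refine hasDerivAt_pi.2 fun i => ?_
  simp only [mulVec, dotProduct]
  exact HasDerivAt.fun_sum fun j _ => (h2 j).const_mul (L i j)

/-- Linear stability of the linearized Z-grid scheme: with a symmetric
discrete Laplacian `L`, the dynamics `h' = -H₀ μ`, `ζ' = -f μ`,
`μ' = -g L h + f ζ` conserves the quadratic energy
`(H₀/2)(⟨μ,μ⟩ + ⟨ζ,ζ⟩) - (g/2)⟨h, L h⟩`. -/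
theorem zgrid_linear_energy_conservation
    (n : ℕ) (L : Matrix (Fin n) (Fin n) ℝ) (hL : Lᵀ = L)
    (f g H₀ : ℝ)
    (h ζ μ : ℝ → Fin n → ℝ)
    (hh : Differentiable ℝ h) (hζ : Differentiable ℝ ζ) (hμ : Differentiable ℝ μ)
    (hht : ∀ t : ℝ, deriv h t = -(H₀ • μ t))
    (hζt : ∀ t : ℝ, deriv ζ t = -(f • μ t))
    (hμt : ∀ t : ℝ, deriv μ t = -(g • L.mulVec (h t)) + f • ζ t) :
    ∀ t s : ℝ,
      (H₀ / 2) * (μ t ⬝ᵥ μ t + ζ t ⬝ᵥ ζ t) - (g / 2) * (h t ⬝ᵥ L.mulVec (h t)) =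
      (H₀ / 2) * (μ s ⬝ᵥ μ s + ζ s ⬝ᵥ ζ s) - (g / 2) * (h s ⬝ᵥ L.mulVec (h s)) := by
  have key : ∀ t, HasDerivAt (fun t => (H₀ / 2) * (μ t ⬝ᵥ μ t + ζ t ⬝ᵥ ζ t)
      - (g / 2) * (h t ⬝ᵥ L.mulVec (h t))) 0 t := by
    intro t
    have dh := (hh t).hasDerivAt
    have dz := (hζ t).hasDerivAt
    have dm := (hμ t).hasDerivAt
    rw [hht] at dh
    rw [hζt] at dz
    rw [hμt] at dm
    have D := (((hasDerivAt_dot dm dm).add (hasDerivAt_dot dz dz)).const_mul (H₀ / 2)).sub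
      ((hasDerivAt_dot dh (hasDerivAt_mulVec' L dh)).const_mul (g / 2))
    refine D.congr_deriv ?_
    have sym : h t ⬝ᵥ L.mulVec (μ t) = μ t ⬝ᵥ L.mulVec (h t) := by
      rw [dotProduct_mulVec, ← mulVec_transpose, hL, dotProduct_comm]
    simp only [add_dotProduct, dotProduct_add, neg_dotProduct, dotProduct_neg, smul_dotProduct,
      dotProduct_smul, mulVec_neg, mulVec_smul, smul_eq_mul, sym,
      dotProduct_comm (L.mulVec (h t)) (μ t), dotProduct_comm (ζ t) (μ t)]
    ring
  intro t s
  exact is_const_of_deriv_eq_zero (fun t => (key t).differentiableAt) (fun t => (key t).deriv) t s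
end

section
/- Let C, E, V be finite types and let D1 : Matrix E V ℝ, D2 : Matrix C E ℝ, D̄1 : Matrix E C ℝ be matrices with D2 * D1 = 0 and D1 · 𝟙 = 0, where 𝟙 denotes the all-ones vector. Let Pv : Matrix V C ℝ and Pe : Matrix E C ℝ be interpolation matrices whose rows each sum to 1 (Pv · 𝟙 = 𝟙 and Pe · 𝟙 = 𝟙), let A : C → ℝ be nonzero cell areas and w : E → ℝ edge weights. Define, for q, ψ, χ : C → ℝ: Jζ(q, ψ)(i) = (1/A i)·( (−1/3)·(D2 · ((D1 · (Pv · q)) ∗ (Pe · ψ)))(i) + (1/3)·(D2 · ((D1 · (Pv · ψ)) ∗ (Pe · q)))(i) ), FD(q, χ)(i) = (1/A i)·(D2 · ((Pe · q) ∗ w ∗ (D̄1 · χ)))(i), and L(χ)(i) = (1/A i)·(D2 · (w ∗ (D̄1 · χ)))(i), where ∗ denotes componentwise multiplication of vectors indexed by E. Then for every constant c ∈ ℝ and every ψ, χ : C → ℝ: Jζ(c·𝟙, ψ) = 0 and FD(c·𝟙, χ) = c · L(χ). -/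
open Matrix

/-- PV compatibility/consistency of the Z-grid operators: for constant
potential vorticity `q = c`, the discrete Jacobian `Jζ(c, ψ)` vanishes and the
flux-divergence satisfies `FD(c, χ) = c L χ`, given `D2 D1 = 0`, `D1 𝟙 = 0`,
and interpolations `Pv`, `Pe` whose rows sum to one. -/
theorem zgrid_pv_compatibility
    {C E V : Type*} [Fintype C] [Fintype E] [Fintype V]
    (D1 : Matrix E V ℝ) (D2 : Matrix C E ℝ) (D1bar : Matrix E C ℝ)
    (hDD : D2 * D1 = 0)
    (hD1one : D1.mulVec (fun _ => (1 : ℝ)) = 0)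
    (Pv : Matrix V C ℝ) (Pe : Matrix E C ℝ)
    (hPv : Pv.mulVec (fun _ => (1 : ℝ)) = fun _ => (1 : ℝ))
    (hPe : Pe.mulVec (fun _ => (1 : ℝ)) = fun _ => (1 : ℝ))
    (A : C → ℝ) (hA : ∀ i, A i ≠ 0)
    (w : E → ℝ)
    (Jζ : (C → ℝ) → (C → ℝ) → C → ℝ)
    (FD : (C → ℝ) → (C → ℝ) → C → ℝ)
    (L : (C → ℝ) → C → ℝ)
    (hJζ : ∀ (q ψ : C → ℝ) (i : C), Jζ q ψ i = (1 / A i) *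
      ((-1 / 3) * (D2.mulVec (fun e => (D1.mulVec (Pv.mulVec q)) e * (Pe.mulVec ψ) e)) i
        + (1 / 3) * (D2.mulVec (fun e => (D1.mulVec (Pv.mulVec ψ)) e * (Pe.mulVec q) e)) i))
    (hFD : ∀ (q χ : C → ℝ) (i : C), FD q χ i =
      (1 / A i) * (D2.mulVec (fun e => (Pe.mulVec q) e * w e * (D1bar.mulVec χ) e)) i)
    (hL : ∀ (χ : C → ℝ) (i : C), L χ i =
      (1 / A i) * (D2.mulVec (fun e => w e * (D1bar.mulVec χ) e)) i) :
    ∀ (c : ℝ) (ψ χ : C → ℝ),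
      Jζ (fun _ => c) ψ = 0 ∧ FD (fun _ => c) χ = c • L χ := by
  intro c ψ χ
  have hc : (fun _ : C => c) = c • (fun _ : C => (1 : ℝ)) := by
    funext i; simp
  have h1 : D1.mulVec (Pv.mulVec (fun _ : C => c)) = 0 := by
    rw [hc, Matrix.mulVec_smul, hPv, Matrix.mulVec_smul, hD1one, smul_zero]
  have h2 : Pe.mulVec (fun _ : C => c) = fun _ => c := by
    rw [hc, Matrix.mulVec_smul, hPe]
    funext e; simp
  constructor
  · funext i
    have h3 : (fun e => (D1.mulVec (Pv.mulVec ψ)) e * c) = c • D1.mulVec (Pv.mulVec ψ) := by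
      funext e; simp [mul_comm]
    have h4 : (fun e => (0 : E → ℝ) e * (Pe.mulVec ψ) e) = 0 := by
      funext e; simp
    rw [hJζ, h1, h2, h3, h4, Matrix.mulVec_smul, Matrix.mulVec_mulVec, hDD]
    simp
  · funext i
    have h5 : (fun e => c * w e * (D1bar.mulVec χ) e)
        = c • (fun e => w e * (D1bar.mulVec χ) e) := by
      funext e; simp [mul_assoc]
    rw [hFD, h2, Pi.smul_apply, hL, h5, Matrix.mulVec_smul, Pi.smul_apply, smul_eq_mul, smul_eq_mul]
    ring
end
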